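/- arXiv:2601.03747 — 6 statements merged into one kernel-verified Lean document; each statement's English description precedes it below -/
import Mathlib

section
/- Let (Ω, F, P) be a probability space and let X : Ω → ℝ^{d×d} be a random matrix taking values P-a.s. in the symmetric positive definite d×d matrices, with E[‖X‖] < ∞ and E[‖X⁻¹‖] < ∞. Then E[X] is symmetric positive definite (in particular invertible), and E[X⁻¹] − (E[X])⁻¹ is positive semidefinite. -/
open MeasureTheory

namespace Matrix

variable {Ω n : Type*} {mΩ : MeasurableSpace Ω} {μ : Measure Ω}
  {M : Ω → Matrix n n ℝ}

lemma isHermitian_integral (h : ∀ᵐ ω ∂μ, (M ω).IsHermitian) :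
    (of fun i j => ∫ ω, M ω i j ∂μ).IsHermitian := by
  refine IsHermitian.ext fun i j => ?_
  simp only [of_apply, star_trivial]
  refine integral_congr_ae ?_
  filter_upwards [h] with ω hω
  simpa using hω.apply i j

variable [Fintype n]

lemma integrable_dotProduct_mulVec (hM : ∀ i j, Integrable (fun ω => M ω i j) μ) (x : n → ℝ) :
    Integrable (fun ω => x ⬝ᵥ (M ω *ᵥ x)) μ := by
  simp only [dotProduct, mulVec]
  exact integrable_finsetSum _ fun i _ =>
    (integrable_finsetSum _ fun j _ => (hM i j).mul_const _).const_mul _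

lemma dotProduct_integral_mulVec (hM : ∀ i j, Integrable (fun ω => M ω i j) μ) (x : n → ℝ) :
    x ⬝ᵥ ((of fun i j => ∫ ω, M ω i j ∂μ) *ᵥ x) = ∫ ω, x ⬝ᵥ (M ω *ᵥ x) ∂μ := by
  simp only [dotProduct, mulVec, of_apply]
  rw [integral_finsetSum _ fun i _ =>
    (integrable_finsetSum _ fun j _ => (hM i j).mul_const _).const_mul _]
  refine Finset.sum_congr rfl fun i _ => ?_
  rw [integral_const_mul, integral_finsetSum _ fun j _ => (hM i j).mul_const _]
  simp only [integral_mul_const]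

lemma PosSemidef.integral (hM : ∀ i j, Integrable (fun ω => M ω i j) μ)
    (h : ∀ᵐ ω ∂μ, (M ω).PosSemidef) : (of fun i j => ∫ ω, M ω i j ∂μ).PosSemidef := by
  refine .of_dotProduct_mulVec_nonneg
    (isHermitian_integral (h.mono fun _ => PosSemidef.isHermitian)) fun x => ?_
  rw [star_trivial, dotProduct_integral_mulVec hM]
  refine integral_nonneg_of_ae ?_
  filter_upwards [h] with ω hω
  simpa using hω.dotProduct_mulVec_nonneg x

lemma PosDef.integral [NeZero μ] (hM : ∀ i j, Integrable (fun ω => M ω i j) μ)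
    (h : ∀ᵐ ω ∂μ, (M ω).PosDef) : (of fun i j => ∫ ω, M ω i j ∂μ).PosDef := by
  refine .of_dotProduct_mulVec_pos
    (isHermitian_integral (h.mono fun _ => PosDef.isHermitian)) fun x hx => ?_
  have hpos : ∀ᵐ ω ∂μ, 0 < x ⬝ᵥ (M ω *ᵥ x) := by
    filter_upwards [h] with ω hω
    simpa using hω.dotProduct_mulVec_pos hx
  have hnonneg : 0 ≤ᵐ[μ] fun ω => x ⬝ᵥ (M ω *ᵥ x) := hpos.mono fun _ => le_of_lt
  rw [star_trivial, dotProduct_integral_mulVec hM]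
  refine (integral_nonneg_of_ae hnonneg).lt_of_ne' fun h0 => ?_
  rw [integral_eq_zero_iff_of_nonneg_ae hnonneg (integrable_dotProduct_mulVec hM x)] at h0
  obtain ⟨ω, hω, hω'⟩ := (hpos.and h0).exists
  exact hω.ne' hω'

lemma PosDef.posSemidef_fromBlocks_inv [DecidableEq n] {A : Matrix n n ℝ} (hA : A.PosDef) :
    (fromBlocks A 1 1 A⁻¹).PosSemidef := by
  have := hA.isUnit.invertible
  have := (PosDef.fromBlocks₁₁ 1 A⁻¹ hA).2 (by simpa using PosSemidef.zero)
  simpa using this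

end Matrix

/-- If a random matrix `X` is almost surely symmetric positive definite, with `X` and `X⁻¹`
integrable (entrywise, equivalently in Frobenius norm), then the (entrywise) expectation
`E[X]` is symmetric positive definite (in particular invertible) and
`E[X⁻¹] − (E[X])⁻¹` is positive semidefinite. -/
theorem stmt1 {Ω : Type*} {mΩ : MeasurableSpace Ω} (μ : Measure Ω) [IsProbabilityMeasure μ]
    {d : ℕ} (X : Ω → Matrix (Fin d) (Fin d) ℝ)
    (hpd : ∀ᵐ ω ∂μ, (X ω).PosDef)
    (hX : ∀ i j, Integrable (fun ω => X ω i j) μ)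
    (hXinv : ∀ i j, Integrable (fun ω => (X ω)⁻¹ i j) μ) :
    (Matrix.of fun i j => ∫ ω, X ω i j ∂μ).PosDef ∧
      ((Matrix.of fun i j => ∫ ω, (X ω)⁻¹ i j ∂μ) -
        (Matrix.of fun i j => ∫ ω, X ω i j ∂μ)⁻¹).PosSemidef := by
  have hE := Matrix.PosDef.integral hX hpd
  refine ⟨hE, ?_⟩
  have hint : ∀ i j, Integrable (fun ω => Matrix.fromBlocks (X ω) 1 1 (X ω)⁻¹ i j) μ := by
    rintro (i | i) (j | j) <;> simp [hX, hXinv]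
  have hblocks := Matrix.PosSemidef.integral hint
    (hpd.mono fun _ => Matrix.PosDef.posSemidef_fromBlocks_inv)
  have := hE.isUnit.invertible
  have hint_eq : (Matrix.of fun i j => ∫ ω, Matrix.fromBlocks (X ω) 1 1 (X ω)⁻¹ i j ∂μ) =
      Matrix.fromBlocks (Matrix.of fun i j => ∫ ω, X ω i j ∂μ) 1 (Matrix.conjTranspose 1)
        (Matrix.of fun i j => ∫ ω, (X ω)⁻¹ i j ∂μ) := by
    ext (i | i) (j | j) <;> simp
  rw [hint_eq, Matrix.PosDef.fromBlocks₁₁ _ _ hE] at hblocks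
  simpa using hblocks
end

section
/- Let (Ω, F, P) be a probability space with filtration (F_t)_{t∈[0,T]} and let η = (η_t)_{t∈[0,T]} be an adapted process of random matrices with values P-a.s. in the symmetric positive definite d×d matrices such that for all 0 ≤ s ≤ t ≤ T one has E[‖η_t‖] < ∞ and E[‖η_s⁻¹ η_t‖] < ∞. Then the following are equivalent: (a) η has uncorrelated multiplicative increments, i.e., for all 0 ≤ s ≤ t ≤ T, E[η_s⁻¹ η_t | F_s] is P-a.s. equal to the constant matrix E[η_s⁻¹ η_t]; (b) the process M = (M_t)_{t∈[0,T]} defined by M_t = η_t (E[η_t])⁻¹ is a martingale with respect to (F_t)_{t∈[0,T]} (note that E[η_t] is positive definite, hence invertible, for every t). -/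
open MeasureTheory

section MatrixCondExp

variable {Ω ι κ l : Type*} {m m₀ : MeasurableSpace Ω}

/-- The entrywise expectation of a random matrix. -/
noncomputable def matrixExp (μ : Measure Ω) (X : Ω → Matrix ι κ ℝ) : Matrix ι κ ℝ :=
  Matrix.of fun i j => ∫ ω, X ω i j ∂μ

/-- The entrywise conditional expectation of a random matrix. -/
noncomputable def matrixCondExp (m : MeasurableSpace Ω) {m₀ : MeasurableSpace Ω} (μ : Measure Ω)
    (X : Ω → Matrix ι κ ℝ) : Ω → Matrix ι κ ℝ :=
  fun ω => Matrix.of fun i j => (μ[(fun ω => X ω i j)|m]) ω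

theorem matrixExp_mul_const [Fintype κ] {μ : Measure Ω} {X : Ω → Matrix ι κ ℝ}
    (hX : ∀ i j, Integrable (fun ω => X ω i j) μ) (D : Matrix κ l ℝ) :
    matrixExp μ (fun ω => X ω * D) = matrixExp μ X * D := by
  ext i j
  simp only [matrixExp, Matrix.of_apply, Matrix.mul_apply]
  rw [integral_finsetSum _ fun k _ => (hX i k).mul_const _]
  exact Finset.sum_congr rfl fun k _ => integral_mul_const _ _

theorem matrixExp_congr_ae {μ : Measure Ω} {X Y : Ω → Matrix ι κ ℝ} (h : X =ᵐ[μ] Y) :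
    matrixExp μ X = matrixExp μ Y := by
  ext i j
  exact integral_congr_ae (h.mono fun ω hω => congrFun (congrFun hω i) j)

theorem matrixExp_const {μ : Measure Ω} [IsProbabilityMeasure μ] (C : Matrix ι κ ℝ) :
    matrixExp μ (fun _ => C) = C := by
  ext i j
  simp [matrixExp]

theorem matrixExp_matrixCondExp (hm : m ≤ m₀) {μ : Measure Ω}
    [IsFiniteMeasure μ] (X : Ω → Matrix ι κ ℝ) :
    matrixExp μ (matrixCondExp m μ X) = matrixExp μ X := by
  ext i j
  exact integral_condExp hm

theorem matrixCondExp_ae_eq_iff [Countable ι] [Countable κ] {μ : Measure Ω}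
    {X Y : Ω → Matrix ι κ ℝ} :
    matrixCondExp m μ X =ᵐ[μ] Y ↔
      ∀ i j, μ[(fun ω => X ω i j)|m] =ᵐ[μ] fun ω => Y ω i j := by
  simp only [Filter.EventuallyEq, ← MeasureTheory.ae_all_iff, matrixCondExp, ← Matrix.ext_iff,
    Matrix.of_apply]

theorem matrixCondExp_mul_const [Fintype κ] [Countable ι] [Countable l]
    {μ : Measure Ω} {X : Ω → Matrix ι κ ℝ}
    (hX : ∀ i j, Integrable (fun ω => X ω i j) μ) (D : Matrix κ l ℝ) :
    matrixCondExp m μ (fun ω => X ω * D) =ᵐ[μ] fun ω => matrixCondExp m μ X ω * D := by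
  rw [matrixCondExp_ae_eq_iff]
  intro i j
  have h₁ : (fun ω => (X ω * D) i j) = ∑ k, D k j • fun ω => X ω i k := by
    ext ω
    simp [Matrix.mul_apply, mul_comm]
  rw [h₁]
  have h₂ := condExp_finsetSum (s := Finset.univ)
    (fun k _ => ((hX i k).smul (D k j))) m
  have h₃ : ∀ᵐ ω ∂μ, ∀ k, (μ[D k j • fun ω => X ω i k|m]) ω
      = (D k j • μ[fun ω => X ω i k|m]) ω :=
    ae_all_iff.2 fun k => condExp_smul _ _ _
  filter_upwards [h₂, h₃] with ω h₂ h₃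
  rw [h₂]
  simp [h₃, Matrix.mul_apply, matrixCondExp, mul_comm]

/-- Pulling out a measurable matrix factor. Only the product matrix has to be integrable, not the
individual summands of its entries. -/
theorem matrixCondExp_mul_of_measurable_left [Fintype ι] [Fintype κ] [Countable l]
    (hm : m ≤ m₀) {μ : Measure Ω} [IsFiniteMeasure μ]
    {A : Ω → Matrix ι κ ℝ} {X : Ω → Matrix κ l ℝ} {Y : Ω → Matrix ι l ℝ}
    (hA : ∀ i j, Measurable[m] fun ω => A ω i j)
    (hX : ∀ i j, Integrable (fun ω => X ω i j) μ)
    (hY : ∀ i j, Integrable (fun ω => Y ω i j) μ)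
    (hAX : Y =ᵐ[μ] fun ω => A ω * X ω) :
    matrixCondExp m μ Y =ᵐ[μ] fun ω => A ω * matrixCondExp m μ X ω := by
  rw [matrixCondExp_ae_eq_iff]
  intro i j
  set S : Ω → ℝ := fun ω => 1 + ∑ k, |A ω i k|
  have hS1 : ∀ ω, 1 ≤ S ω := fun ω =>
    le_add_of_nonneg_right (Finset.sum_nonneg fun k _ => abs_nonneg _)
  have hAS : ∀ ω k, |A ω i k| ≤ S ω := fun ω k =>
    (Finset.single_le_sum (f := fun k => |A ω i k|) (fun k _ => abs_nonneg _)
      (Finset.mem_univ k)).trans (le_add_of_nonneg_left zero_le_one)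
  have hSm : Measurable[m] S :=
    measurable_const.add (Finset.measurable_sum _ fun k _ =>
      continuous_abs.measurable.comp (hA i k))
  have hφm : Measurable[m] fun ω => (S ω)⁻¹ := hSm.inv
  have hψm : ∀ k, Measurable[m] fun ω => (S ω)⁻¹ * A ω i k := fun k => hφm.mul (hA i k)
  have hφY : Integrable ((fun ω => (S ω)⁻¹) * fun ω => Y ω i j) μ := by
    refine (hY i j).bdd_mul (c := 1) (hφm.mono hm le_rfl).aestronglyMeasurable ?_
    refine Filter.Eventually.of_forall fun ω => ?_
    rw [Real.norm_eq_abs, abs_of_nonneg (inv_nonneg.2 (zero_le_one.trans (hS1 ω)))]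
    exact inv_le_one_of_one_le₀ (hS1 ω)
  have hψX : ∀ k, Integrable ((fun ω => (S ω)⁻¹ * A ω i k) * fun ω => X ω k j) μ := by
    intro k
    refine (hX k j).bdd_mul (c := 1) ((hψm k).mono hm le_rfl).aestronglyMeasurable ?_
    refine Filter.Eventually.of_forall fun ω => ?_
    have h0 : 0 < S ω := zero_lt_one.trans_le (hS1 ω)
    rw [Real.norm_eq_abs, abs_mul, abs_of_pos (inv_pos.2 h0), inv_mul_le_iff₀ h0, mul_one]
    exact hAS ω k
  have hsum : ((fun ω => (S ω)⁻¹) * fun ω => Y ω i j) =ᵐ[μ]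
      ∑ k, (fun ω => (S ω)⁻¹ * A ω i k) * fun ω => X ω k j := by
    filter_upwards [hAX] with ω hω
    simp [hω, Matrix.mul_apply, Finset.mul_sum, mul_assoc]
  have h₁ := condExp_mul_of_stronglyMeasurable_left hφm.stronglyMeasurable hφY (hY i j)
  have h₂ := condExp_finsetSum (s := Finset.univ) (fun k _ => hψX k) m
  have h₃ : ∀ᵐ ω ∂μ, ∀ k,
      (μ[(fun ω => (S ω)⁻¹ * A ω i k) * (fun ω => X ω k j)|m]) ω
        = ((fun ω => (S ω)⁻¹ * A ω i k) * μ[fun ω => X ω k j|m]) ω :=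
    ae_all_iff.2 fun k =>
      condExp_mul_of_stronglyMeasurable_left (hψm k).stronglyMeasurable (hψX k) (hX k j)
  filter_upwards [h₁, h₂, h₃, condExp_congr_ae (m := m) hsum] with ω h₁ h₂ h₃ h₄
  have h0 : 0 < S ω := zero_lt_one.trans_le (hS1 ω)
  refine mul_left_cancel₀ (inv_pos.2 h0).ne' ?_
  have h₅ := h₁.symm.trans (h₄.trans h₂)
  simp only [Pi.mul_apply, Finset.sum_apply, h₃] at h₅
  rw [h₅]
  simp [Matrix.mul_apply, matrixCondExp, Finset.mul_sum, mul_assoc]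

theorem measurable_matrix_det [Fintype ι] [DecidableEq ι] {m : MeasurableSpace Ω}
    {A : Ω → Matrix ι ι ℝ} (hA : ∀ i j, Measurable fun ω => A ω i j) :
    Measurable fun ω => (A ω).det := by
  simp only [Matrix.det_apply']
  exact Finset.measurable_sum _ fun σ _ =>
    measurable_const.mul (Finset.measurable_prod _ fun k _ => hA _ _)

theorem measurable_matrix_inv_apply [Fintype ι] [DecidableEq ι] {m : MeasurableSpace Ω}
    {A : Ω → Matrix ι ι ℝ} (hA : ∀ i j, Measurable fun ω => A ω i j) (i j : ι) :
    Measurable fun ω => (A ω)⁻¹ i j := by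
  simp only [Matrix.inv_def, Ring.inverse_eq_inv', Matrix.smul_apply, Matrix.adjugate_apply,
    smul_eq_mul]
  refine (measurable_matrix_det hA).inv.mul (measurable_matrix_det fun a b => ?_)
  by_cases h : a = j
  · subst h
    simp
  · simpa [Matrix.updateRow_ne h] using hA a b

theorem posDef_matrixExp [Fintype ι] {μ : Measure Ω} [IsProbabilityMeasure μ]
    {X : Ω → Matrix ι ι ℝ} (hX : ∀ i j, Integrable (fun ω => X ω i j) μ)
    (hpd : ∀ᵐ ω ∂μ, (X ω).PosDef) : (matrixExp μ X).PosDef := by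
  refine Matrix.PosDef.of_dotProduct_mulVec_pos ?_ fun x hx => ?_
  · ext i j
    simp only [matrixExp, Matrix.conjTranspose_apply, Matrix.of_apply, star_trivial]
    refine integral_congr_ae (hpd.mono fun ω hω => ?_)
    simpa using hω.isHermitian.apply i j
  · have hI : ∀ i j, Integrable (fun ω => x i * (X ω i j * x j)) μ := fun i j =>
      ((hX i j).mul_const _).const_mul _
    have hI' : Integrable (fun ω => ∑ i, ∑ j, x i * (X ω i j * x j)) μ :=
      integrable_finsetSum _ fun i _ => integrable_finsetSum _ fun j _ => hI i j
    have hpos : ∀ᵐ ω ∂μ, 0 < ∑ i, ∑ j, x i * (X ω i j * x j) := by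
      filter_upwards [hpd] with ω hω
      simpa [dotProduct, Matrix.mulVec, Finset.mul_sum] using hω.dotProduct_mulVec_pos hx
    have hlt : 0 < ∫ ω, ∑ i, ∑ j, x i * (X ω i j * x j) ∂μ := by
      rw [integral_pos_iff_support_of_nonneg_ae (hpos.mono fun ω h => h.le) hI']
      refine pos_iff_ne_zero.2 fun h0 => ?_
      have h1 : ∀ᵐ ω ∂μ, ω ∉ Function.support fun ω => ∑ i, ∑ j, x i * (X ω i j * x j) :=
        measure_eq_zero_iff_ae_notMem.1 h0
      obtain ⟨ω, h, h'⟩ := (hpos.and h1).exists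
      exact h' h.ne'
    refine hlt.trans_eq ?_
    rw [integral_finsetSum _ fun i _ => integrable_finsetSum _ fun j _ => hI i j]
    simp only [dotProduct, Matrix.mulVec, matrixExp, Matrix.of_apply, star_trivial,
      Finset.mul_sum]
    refine Finset.sum_congr rfl fun i _ => ?_
    rw [integral_finsetSum _ fun j _ => hI i j]
    refine Finset.sum_congr rfl fun j _ => ?_
    rw [integral_const_mul, integral_mul_const]

/-- For a single pair of times: the conditional expectation of the multiplicative increment
`A⁻¹ B` is constant iff normalising by the expectation turns `A, B` into a one-step martingale. -/
theorem matrixCondExp_inv_mul_eq_const_iff [Fintype ι] [DecidableEq ι] (hm : m ≤ m₀)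
    {μ : Measure Ω} [IsProbabilityMeasure μ] {A B : Ω → Matrix ι ι ℝ}
    (hAm : ∀ i j, Measurable[m] fun ω => A ω i j)
    (hA : ∀ i j, Integrable (fun ω => A ω i j) μ) (hB : ∀ i j, Integrable (fun ω => B ω i j) μ)
    (hAB : ∀ i j, Integrable (fun ω => ((A ω)⁻¹ * B ω) i j) μ)
    (hAu : ∀ᵐ ω ∂μ, IsUnit (A ω).det) (hEA : IsUnit (matrixExp μ A).det)
    (hEB : IsUnit (matrixExp μ B).det) :
    matrixCondExp m μ (fun ω => (A ω)⁻¹ * B ω)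
        =ᵐ[μ] (fun _ => matrixExp μ fun ω => (A ω)⁻¹ * B ω) ↔
      matrixCondExp m μ (fun ω => B ω * (matrixExp μ B)⁻¹)
        =ᵐ[μ] fun ω => A ω * (matrixExp μ A)⁻¹ := by
  have hmul := matrixCondExp_mul_const (m := m) hB (matrixExp μ B)⁻¹
  constructor
  · intro h
    set C := matrixExp μ fun ω => (A ω)⁻¹ * B ω
    have hpull : matrixCondExp m μ B =ᵐ[μ] fun ω => A ω * C := by
      refine (matrixCondExp_mul_of_measurable_left hm hAm hAB hB ?_).trans
        (h.mono fun ω hω => congrArg (A ω * ·) hω)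
      filter_upwards [hAu] with ω hω
      rw [Matrix.mul_nonsing_inv_cancel_left _ _ hω]
    have hE : matrixExp μ B = matrixExp μ A * C := by
      rw [← matrixExp_matrixCondExp hm B, matrixExp_congr_ae hpull, matrixExp_mul_const hA]
    have hC : C * (matrixExp μ B)⁻¹ = (matrixExp μ A)⁻¹ := by
      rw [← Matrix.nonsing_inv_mul_cancel_left (A := matrixExp μ A) C hEA, ← hE, Matrix.mul_assoc,
        Matrix.mul_nonsing_inv _ hEB, Matrix.mul_one]
    filter_upwards [hmul, hpull] with ω h₁ h₂
    rw [h₁, h₂, Matrix.mul_assoc, hC]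
  · intro h
    have hpull := matrixCondExp_mul_of_measurable_left hm (measurable_matrix_inv_apply hAm) hB hAB
      (Filter.EventuallyEq.refl _ _)
    have hconst : matrixCondExp m μ (fun ω => (A ω)⁻¹ * B ω)
        =ᵐ[μ] fun _ => (matrixExp μ A)⁻¹ * matrixExp μ B := by
      filter_upwards [hpull, hmul, h, hAu] with ω h₁ h₂ h₃ h₄
      rw [h₁, ← Matrix.nonsing_inv_mul_cancel_right (A := matrixExp μ B)
        (matrixCondExp m μ B ω) hEB, ← h₂, h₃, Matrix.mul_assoc,
        Matrix.nonsing_inv_mul_cancel_left _ _ h₄]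
    rw [← matrixExp_matrixCondExp hm, matrixExp_congr_ae hconst, matrixExp_const]
    exact hconst

end MatrixCondExp

/-- For an adapted, a.s. symmetric positive definite and suitably integrable matrix-valued
process `η` on `[0,T]`, the entrywise expectations `E[η_t]` are positive definite (hence
invertible), and `η` has uncorrelated multiplicative increments (i.e. for all `s ≤ t`,
`E[η_s⁻¹ η_t | F_s]` is a.s. equal to the constant matrix `E[η_s⁻¹ η_t]`) if and only if
the process `M_t = η_t (E[η_t])⁻¹` is a martingale with respect to the filtration. -/
theorem stmt4 {Ω : Type*} {m : MeasurableSpace Ω} (μ : Measure Ω) [IsProbabilityMeasure μ]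
    {d : ℕ} {T : ℝ} (hT : 0 < T)
    (𝓕 : Filtration (Set.Icc (0 : ℝ) T) m)
    (η : Set.Icc (0 : ℝ) T → Ω → Matrix (Fin d) (Fin d) ℝ)
    (hadapted : ∀ t i j, Measurable[𝓕 t] fun ω => η t ω i j)
    (hpd : ∀ t, ∀ᵐ ω ∂μ, (η t ω).PosDef)
    (hint : ∀ t i j, Integrable (fun ω => η t ω i j) μ)
    (hprodint : ∀ s t, s ≤ t → ∀ i j, Integrable (fun ω => ((η s ω)⁻¹ * η t ω) i j) μ) :
    (∀ t, (Matrix.of fun a b => ∫ ω, η t ω a b ∂μ).PosDef) ∧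
    ((∀ s t, s ≤ t → ∀ i j,
        μ[(fun ω => ((η s ω)⁻¹ * η t ω) i j)|𝓕 s]
          =ᵐ[μ] fun _ => ∫ ω, ((η s ω)⁻¹ * η t ω) i j ∂μ) ↔
      (∀ s t, s ≤ t → ∀ i j,
        μ[(fun ω => (η t ω * (Matrix.of fun a b => ∫ ω', η t ω' a b ∂μ)⁻¹) i j)|𝓕 s]
          =ᵐ[μ] fun ω => (η s ω * (Matrix.of fun a b => ∫ ω', η s ω' a b ∂μ)⁻¹) i j)) := by
  have hE : ∀ t, (matrixExp μ (η t)).PosDef := fun t => posDef_matrixExp (hint t) (hpd t)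
  refine ⟨hE, ?_⟩
  refine forall_congr' fun s => forall_congr' fun t => forall_congr' fun hst => ?_
  have hunit : ∀ {M : Matrix (Fin d) (Fin d) ℝ}, M.PosDef → IsUnit M.det := fun h =>
    h.det_pos.ne'.isUnit
  have key := matrixCondExp_inv_mul_eq_const_iff (𝓕.le s) (hadapted s) (hint s) (hint t)
    (hprodint s t hst) ((hpd s).mono fun ω => hunit) (hunit (hE s)) (hunit (hE t))
  rwa [matrixCondExp_ae_eq_iff, matrixCondExp_ae_eq_iff] at key
end

section
/- Let (Ω, F, P) be a probability space, let G ⊆ F be a sub-σ-algebra, let N : Ω → ℝ^{d×d} be G-measurable with values P-a.s. in the symmetric positive definite d×d matrices, and let R : Ω → ℝ^{d×d} be a random matrix with values P-a.s. in the symmetric d×d matrices such that E[‖R‖] < ∞ and E[‖R N⁻¹ R‖] < ∞. Then P-a.s. the matrix E[R N⁻¹ R | G] − E[R | G] N⁻¹ E[R | G] is positive semidefinite; equivalently, for every x ∈ ℝ^d, P-a.s. ⟨x, E[R | G] N⁻¹ E[R | G] x⟩ ≤ ⟨x, E[R N⁻¹ R | G] x⟩. -/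
open MeasureTheory

/-- Completing the square: `2⟨y, Rx⟩ - ⟨x, R N⁻¹ R x⟩ ≤ ⟨y, N y⟩`. -/
lemma Matrix.PosDef.two_mul_dotProduct_sub_le {n : Type*} [Fintype n] [DecidableEq n]
    {N R : Matrix n n ℝ} (hN : N.PosDef) (hR : R.IsSymm) (x y : n → ℝ) :
    2 * (y ⬝ᵥ R.mulVec x) - x ⬝ᵥ (R * N⁻¹ * R).mulVec x ≤ y ⬝ᵥ N.mulVec y := by
  have hdet : IsUnit N.det := hN.det_pos.ne'.isUnit
  have hsymm : N.transpose = N := by simpa using hN.isHermitian.eq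
  set v := R.mulVec x with hv
  set w := N⁻¹.mulVec v with hw
  have hNw : N.mulVec w = v := by
    rw [hw, Matrix.mulVec_mulVec, Matrix.mul_nonsing_inv _ hdet, Matrix.one_mulVec]
  have hx : x ⬝ᵥ (R * N⁻¹ * R).mulVec x = w ⬝ᵥ v := by
    rw [← Matrix.mulVec_mulVec, ← Matrix.mulVec_mulVec, Matrix.dotProduct_mulVec,
      ← Matrix.mulVec_transpose, hR.eq, dotProduct_comm]
  have hwy : w ⬝ᵥ N.mulVec y = y ⬝ᵥ v := by
    rw [Matrix.dotProduct_mulVec, ← Matrix.mulVec_transpose, hsymm, hNw, dotProduct_comm]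
  have h : 0 ≤ (y - w) ⬝ᵥ N.mulVec (y - w) := by
    simpa using hN.posSemidef.dotProduct_mulVec_nonneg (y - w)
  rw [Matrix.mulVec_sub, hNw, sub_dotProduct, dotProduct_sub, dotProduct_sub, hwy] at h
  rw [hx]
  linarith

/-- The quadratic form of a Schur-type complement is nonnegative once the associated
affine minorants are. -/
lemma Matrix.PosDef.posSemidef_sub_mul_inv_mul {n : Type*} [Fintype n] [DecidableEq n]
    {N A C : Matrix n n ℝ} (hN : N.PosDef) (hA : A.IsSymm) (hC : C.IsSymm)
    (h : ∀ x y : n → ℝ, 2 * (y ⬝ᵥ A.mulVec x) - x ⬝ᵥ C.mulVec x ≤ y ⬝ᵥ N.mulVec y) :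
    (C - A * N⁻¹ * A).PosSemidef := by
  have hdet : IsUnit N.det := hN.det_pos.ne'.isUnit
  have hsymm : N.transpose = N := by simpa using hN.isHermitian.eq
  refine Matrix.PosSemidef.of_dotProduct_mulVec_nonneg ?_ fun x => ?_
  · rw [Matrix.IsHermitian, Matrix.conjTranspose_eq_transpose_of_trivial, Matrix.transpose_sub,
      Matrix.transpose_mul, Matrix.transpose_mul, Matrix.transpose_nonsing_inv, hA.eq, hC.eq,
      hsymm, Matrix.mul_assoc]
  · have hNw : N.mulVec (N⁻¹.mulVec (A.mulVec x)) = A.mulVec x := by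
      rw [Matrix.mulVec_mulVec, Matrix.mul_nonsing_inv _ hdet, Matrix.one_mulVec]
    have hx : x ⬝ᵥ (A * N⁻¹ * A).mulVec x = N⁻¹.mulVec (A.mulVec x) ⬝ᵥ A.mulVec x := by
      rw [← Matrix.mulVec_mulVec, ← Matrix.mulVec_mulVec, Matrix.dotProduct_mulVec,
        ← Matrix.mulVec_transpose, hA.eq, dotProduct_comm]
    have := h x (N⁻¹.mulVec (A.mulVec x))
    rw [hNw] at this
    rw [star_trivial, Matrix.sub_mulVec, dotProduct_sub, hx]
    linarith

/-- A `G`-measurable upper bound, not assumed integrable, also bounds the conditional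
expectation. -/
lemma condExp_le_of_ae_le_of_measurable {Ω : Type*} {m : MeasurableSpace Ω} {μ : Measure Ω}
    [IsFiniteMeasure μ] {G : MeasurableSpace Ω} (hG : G ≤ m) {f g : Ω → ℝ}
    (hf : Integrable f μ) (hg : Measurable[G] g) (hfg : f ≤ᵐ[μ] g) : μ[f|G] ≤ᵐ[μ] g := by
  have key : ∀ n : ℕ, ∀ᵐ ω ∂μ, |g ω| ≤ n → (μ[f|G]) ω ≤ g ω := by
    intro n
    set s : Set Ω := {ω | |g ω| ≤ n}
    have hs : MeasurableSet[G] s := by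
      have hIcc : s = g ⁻¹' Set.Icc (-(n : ℝ)) n := by
        ext ω
        exact abs_le (a := g ω)
      rw [hIcc]
      exact hg measurableSet_Icc
    have hgs : StronglyMeasurable[G] (s.indicator g) := (hg.indicator hs).stronglyMeasurable
    have hgint : Integrable (s.indicator g) μ := by
      refine Integrable.of_bound (hgs.mono hG).aestronglyMeasurable (n : ℝ) (ae_of_all _ fun ω => ?_)
      by_cases hω : ω ∈ s
      · rw [Set.indicator_of_mem hω]
        exact hω
      · simp [hω]
    have hle : s.indicator f ≤ᵐ[μ] s.indicator g := by
      filter_upwards [hfg] with ω hω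
      exact Set.indicator_le_indicator hω
    have hmono := condExp_mono (m := G) (hf.indicator (hG s hs)) hgint hle
    rw [condExp_of_stronglyMeasurable hG hgs hgint] at hmono
    filter_upwards [hmono, condExp_indicator hf hs] with ω h1 h2 hω
    have hω : ω ∈ s := hω
    rw [h2] at h1
    simpa [hω] using h1
  filter_upwards [ae_all_iff.2 key] with ω hω
  obtain ⟨n, hn⟩ := exists_nat_ge |g ω|
  exact hω n hn

lemma integrable_dotProduct_mulVec {Ω n : Type*} [Fintype n] {m : MeasurableSpace Ω}
    {μ : Measure Ω} {M : Ω → Matrix n n ℝ} (hM : ∀ i j, Integrable (fun ω => M ω i j) μ)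
    (x y : n → ℝ) : Integrable (fun ω => x ⬝ᵥ (M ω).mulVec y) μ := by
  simp only [dotProduct, Matrix.mulVec]
  exact integrable_finsetSum _ fun i _ => (integrable_finsetSum _ fun j _ =>
    (hM i j).mul_const (y j)).const_mul (x i)

/-- Bilinear forms commute with the entrywise conditional expectation of a matrix. -/
lemma condExp_dotProduct_mulVec {Ω n : Type*} [Fintype n] {m : MeasurableSpace Ω}
    {μ : Measure Ω} (G : MeasurableSpace Ω) {M : Ω → Matrix n n ℝ}
    (hM : ∀ i j, Integrable (fun ω => M ω i j) μ) (x y : n → ℝ) :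
    μ[(fun ω => x ⬝ᵥ (M ω).mulVec y)|G] =ᵐ[μ]
      fun ω => x ⬝ᵥ (Matrix.of fun i j => (μ[(fun ω' => M ω' i j)|G]) ω).mulVec y := by
  have hsum : (fun ω => x ⬝ᵥ (M ω).mulVec y) =
      ∑ p : n × n, (x p.1 * y p.2) • fun ω => M ω p.1 p.2 := by
    ext ω
    simp only [dotProduct, Matrix.mulVec, Finset.sum_apply, Pi.smul_apply, smul_eq_mul,
      Fintype.sum_prod_type, Finset.mul_sum]
    exact Finset.sum_congr rfl fun i _ => Finset.sum_congr rfl fun j _ => by ring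
  rw [hsum]
  have hsmul : ∀ᵐ ω ∂μ, ∀ p : n × n, (μ[(x p.1 * y p.2) • fun ω => M ω p.1 p.2|G]) ω =
      (x p.1 * y p.2) * (μ[fun ω => M ω p.1 p.2|G]) ω :=
    ae_all_iff.2 fun p => condExp_smul (x p.1 * y p.2) (fun ω => M ω p.1 p.2) G
  filter_upwards [hsmul, condExp_finsetSum (s := Finset.univ)
    (fun (p : n × n) _ => (hM p.1 p.2).smul (x p.1 * y p.2)) G] with ω h1 h2
  rw [h2, Finset.sum_apply, Finset.sum_congr rfl fun p _ => h1 p]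
  simp only [dotProduct, Matrix.mulVec, Fintype.sum_prod_type, Finset.mul_sum, Matrix.of_apply]
  exact Finset.sum_congr rfl fun i _ => Finset.sum_congr rfl fun j _ => by ring

lemma ae_isSymm_condExp {Ω n : Type*} [Finite n] {m : MeasurableSpace Ω}
    {μ : Measure Ω} (G : MeasurableSpace Ω) {M : Ω → Matrix n n ℝ}
    (hM : ∀ᵐ ω ∂μ, (M ω).IsSymm) :
    ∀ᵐ ω ∂μ, (Matrix.of fun i j => (μ[(fun ω' => M ω' i j)|G]) ω).IsSymm := by
  have hcongr : ∀ i j, μ[(fun ω' => M ω' j i)|G] =ᵐ[μ] μ[(fun ω' => M ω' i j)|G] := fun i j =>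
    condExp_congr_ae (hM.mono fun ω hω => hω.apply i j)
  filter_upwards [ae_all_iff.2 fun i => ae_all_iff.2 (hcongr i)] with ω hω
  exact Matrix.IsSymm.ext hω

/-- Conditional matrix Cauchy–Schwarz/Jensen inequality: if `N` is `G`-measurable with a.s.
symmetric positive definite values and `R` is a.s. symmetric with `R` and `R N⁻¹ R`
integrable, then a.s. `E[R N⁻¹ R | G] − E[R | G] N⁻¹ E[R | G]` is positive semidefinite
(conditional expectations taken entrywise). -/
theorem stmt5 {Ω : Type*} {m : MeasurableSpace Ω} (μ : Measure Ω) [IsProbabilityMeasure μ]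
    {d : ℕ} (G : MeasurableSpace Ω) (hG : G ≤ m)
    (N R : Ω → Matrix (Fin d) (Fin d) ℝ)
    (hNmeas : ∀ i j, Measurable[G] fun ω => N ω i j)
    (hNpd : ∀ᵐ ω ∂μ, (N ω).PosDef)
    (hRsymm : ∀ᵐ ω ∂μ, (R ω).IsSymm)
    (hRint : ∀ i j, Integrable (fun ω => R ω i j) μ)
    (hRNRint : ∀ i j, Integrable (fun ω => (R ω * (N ω)⁻¹ * R ω) i j) μ) :
    ∀ᵐ ω ∂μ,
      ((Matrix.of fun i j => (μ[(fun ω' => (R ω' * (N ω')⁻¹ * R ω') i j)|G]) ω) -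
        (Matrix.of fun i j => (μ[(fun ω' => R ω' i j)|G]) ω) * (N ω)⁻¹ *
          (Matrix.of fun i j => (μ[(fun ω' => R ω' i j)|G]) ω)).PosSemidef := by
  have hbound : ∀ p : (Fin d → ℝ) × (Fin d → ℝ), ∀ᵐ ω ∂μ,
      2 * (p.2 ⬝ᵥ (Matrix.of fun i j => (μ[(fun ω' => R ω' i j)|G]) ω).mulVec p.1) -
        p.1 ⬝ᵥ (Matrix.of fun i j =>
          (μ[(fun ω' => (R ω' * (N ω')⁻¹ * R ω') i j)|G]) ω).mulVec p.1 ≤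
        p.2 ⬝ᵥ (N ω).mulVec p.2 := by
    rintro ⟨x, y⟩
    have hR := integrable_dotProduct_mulVec hRint y x
    have hRNR := integrable_dotProduct_mulVec hRNRint x x
    have hmeas : Measurable[G] fun ω => y ⬝ᵥ (N ω).mulVec y := by
      simp only [dotProduct, Matrix.mulVec]
      exact Finset.measurable_sum _ fun i _ => (Finset.measurable_sum _ fun j _ =>
        (hNmeas i j).mul_const (y j)).const_mul (y i)
    have hle := condExp_le_of_ae_le_of_measurable hG ((hR.smul (2 : ℝ)).sub hRNR) hmeas (by
      filter_upwards [hNpd, hRsymm] with ω h1 h2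
      exact h1.two_mul_dotProduct_sub_le h2 x y)
    filter_upwards [hle, condExp_sub (hR.smul (2 : ℝ)) hRNR G,
      condExp_smul (2 : ℝ) (fun ω => y ⬝ᵥ (R ω).mulVec x) G,
      condExp_dotProduct_mulVec G hRint y x, condExp_dotProduct_mulVec G hRNRint x x]
      with ω h1 h2 h3 h4 h5
    rw [h2, Pi.sub_apply, h3, Pi.smul_apply, h4, h5, smul_eq_mul] at h1
    exact h1
  have hRNRsymm : ∀ᵐ ω ∂μ, (R ω * (N ω)⁻¹ * R ω).IsSymm := by
    filter_upwards [hNpd, hRsymm] with ω h1 h2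
    have hN : (N ω).transpose = N ω := by simpa using h1.isHermitian.eq
    rw [Matrix.IsSymm, Matrix.transpose_mul, Matrix.transpose_mul, Matrix.transpose_nonsing_inv,
      h2.eq, hN, Matrix.mul_assoc]
  filter_upwards [hNpd, ae_isSymm_condExp G hRsymm, ae_isSymm_condExp G hRNRsymm,
    ae_all_iff.2 fun k : ℕ =>
      hbound (TopologicalSpace.denseSeq ((Fin d → ℝ) × (Fin d → ℝ)) k)] with ω hN hA hC hω
  refine hN.posSemidef_sub_mul_inv_mul hA hC fun x y => ?_
  refine (TopologicalSpace.denseRange_denseSeq ((Fin d → ℝ) × (Fin d → ℝ))).induction_on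
    (p := fun p => 2 * (p.2 ⬝ᵥ (Matrix.of fun i j => (μ[(fun ω' => R ω' i j)|G]) ω).mulVec p.1) -
        p.1 ⬝ᵥ (Matrix.of fun i j =>
          (μ[(fun ω' => (R ω' * (N ω')⁻¹ * R ω') i j)|G]) ω).mulVec p.1 ≤
        p.2 ⬝ᵥ (N ω).mulVec p.2) (x, y) (isClosed_le ?_ ?_) hω
  · fun_prop
  · fun_prop
end

section
/- Let 0 ≤ t < T, c ≥ 0 and x₀ ∈ ℝ. Let y : [t,T) → ℝ be differentiable with y(t) = x₀ and y′(s) ≤ (c − 2/(T − s)) y(s) for all s ∈ [t,T). Then for all s ∈ [t,T) one has y(s) ≤ x₀ · e^{c (s − t)} · (T − s)² / (T − t)². -/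
/-- Gronwall-type estimate: if `y` is differentiable on `[t,T)` with `y(t) = x₀` and
`y′(s) ≤ (c − 2/(T − s)) y(s)` on `[t,T)`, then
`y(s) ≤ x₀ e^{c(s−t)} (T−s)²/(T−t)²` for all `s ∈ [t,T)`. -/
theorem stmt7 (t T c x₀ : ℝ) (ht : 0 ≤ t) (htT : t < T) (hc : 0 ≤ c)
    (y y' : ℝ → ℝ) (hyt : y t = x₀)
    (hderiv : ∀ s ∈ Set.Ico t T, HasDerivWithinAt y (y' s) (Set.Ico t T) s)
    (hineq : ∀ s ∈ Set.Ico t T, y' s ≤ (c - 2 / (T - s)) * y s) :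
    ∀ s ∈ Set.Ico t T,
      y s ≤ x₀ * Real.exp (c * (s - t)) * (T - s) ^ 2 / (T - t) ^ 2 := by
  have hg : ∀ s ∈ Set.Ico t T,
      HasDerivWithinAt (fun s => y s * Real.exp (-(c * (s - t))) / (T - s) ^ 2)
        (Real.exp (-(c * (s - t))) / (T - s) ^ 2 * (y' s - (c - 2 / (T - s)) * y s))
        (Set.Ico t T) s := by
    intro s hs
    have hpos : 0 < T - s := sub_pos.2 hs.2
    have hexp : HasDerivWithinAt (fun s => Real.exp (-(c * (s - t))))
        (Real.exp (-(c * (s - t))) * -(c * 1)) (Set.Ico t T) s :=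
      ((((hasDerivAt_id s).sub_const t).const_mul c).neg.exp).hasDerivWithinAt
    have hsq : HasDerivWithinAt (fun s => (T - s) ^ 2)
        (2 * (T - s) * -1) (Set.Ico t T) s :=
      (((hasDerivAt_id s).const_sub T).fun_pow 2).hasDerivWithinAt.congr_deriv (by simp)
    refine (((hderiv s hs).mul hexp).div hsq (pow_ne_zero 2 hpos.ne')).congr_deriv ?_
    simp only [Pi.mul_apply]
    field_simp
    ring
  have hanti : AntitoneOn (fun s => y s * Real.exp (-(c * (s - t))) / (T - s) ^ 2)
      (Set.Ico t T) := by
    refine antitoneOn_of_hasDerivWithinAt_nonpos (convex_Ico t T)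
      (fun s hs => (hg s hs).continuousWithinAt)
      (fun s hs => (hg s (interior_subset hs)).mono interior_subset) fun s hs => ?_
    exact mul_nonpos_of_nonneg_of_nonpos (by positivity)
      (sub_nonpos.2 (hineq s (interior_subset hs)))
  intro s hs
  have hpos : 0 < T - s := sub_pos.2 hs.2
  have h := hanti (Set.left_mem_Ico.2 htT) hs hs.1
  simp only [sub_self, mul_zero, neg_zero, Real.exp_zero, mul_one, hyt] at h
  rw [div_le_iff₀ (by positivity), Real.exp_neg, ← div_eq_mul_inv,
    div_le_iff₀ (Real.exp_pos _)] at h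
  exact h.trans_eq (by ring)
end

section
/- Let d ∈ ℕ, T > 0, let ξ be a symmetric positive definite d×d matrix, and let η : [0,T] → ℝ^{d×d} be measurable with η_s symmetric positive definite for almost every s and with s ↦ η_s⁻¹ (Lebesgue-)integrable on [0,T]. For t ∈ [0,T] define R_t = (ξ⁻¹ + ∫_t^T η_s⁻¹ ds)⁻¹ (the matrix being inverted is positive definite, hence invertible). Then R_T = ξ and for every t ∈ [0,T] one has R_t = ξ − ∫_t^T R_s η_s⁻¹ R_s ds; that is, R is a solution of the terminal-value matrix Riccati equation dR_t/dt = R_t η_t⁻¹ R_t, R_T = ξ. -/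
open MeasureTheory intervalIntegral

/-- The candidate solution `R_t = (ξ⁻¹ + ∫_t^T η_s⁻¹ ds)⁻¹` of the terminal-value matrix
Riccati equation (integrals taken entrywise). -/
noncomputable def Rmat {d : ℕ} (T : ℝ) (ξ : Matrix (Fin d) (Fin d) ℝ)
    (η : ℝ → Matrix (Fin d) (Fin d) ℝ) (t : ℝ) : Matrix (Fin d) (Fin d) ℝ :=
  (ξ⁻¹ + Matrix.of fun i j => ∫ s in t..T, (η s)⁻¹ i j)⁻¹

section AbsolutelyContinuous

variable {X Y E : Type*} [PseudoMetricSpace X] [PseudoMetricSpace Y] [NormedAddCommGroup E]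

theorem AbsolutelyContinuousOnInterval.of_dist_le {f : ℝ → X} {g : ℝ → Y} {a b K : ℝ}
    (hg : AbsolutelyContinuousOnInterval g a b)
    (h : ∀ x ∈ Set.uIcc a b, ∀ y ∈ Set.uIcc a b, dist (f x) (f y) ≤ K * dist (g x) (g y)) :
    AbsolutelyContinuousOnInterval f a b := by
  unfold AbsolutelyContinuousOnInterval at hg ⊢
  refine squeeze_zero' (.of_forall fun _ ↦ Finset.sum_nonneg fun _ _ ↦ dist_nonneg) ?_
    (by simpa using hg.const_mul K)
  rw [Filter.eventually_inf_principal]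
  filter_upwards with E hE
  rw [Finset.mul_sum]
  exact Finset.sum_le_sum fun i hi ↦ h _ (hE.1 i hi).1 _ (hE.1 i hi).2

theorem IntervalIntegrable.absolutelyContinuousOnInterval_integral [NormedSpace ℝ E]
    {g : ℝ → E} {a b c : ℝ} (hg : IntervalIntegrable g volume a b) (hc : c ∈ Set.uIcc a b) :
    AbsolutelyContinuousOnInterval (fun x ↦ ∫ s in c..x, g s) a b := by
  refine (hg.norm.absolutelyContinuousOnInterval_intervalIntegral hc).of_dist_le (K := 1)
    fun x hx y hy ↦ ?_
  have hcx : IntervalIntegrable g volume c x := hg.mono_set (Set.uIcc_subset_uIcc hc hx)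
  have hcy : IntervalIntegrable g volume c y := hg.mono_set (Set.uIcc_subset_uIcc hc hy)
  rw [one_mul, dist_eq_norm, Real.dist_eq, integral_interval_sub_left hcx hcy,
    integral_interval_sub_left hcx.norm hcy.norm]
  exact norm_integral_le_abs_integral_norm

end AbsolutelyContinuous

section BanachAlgebra

variable {𝔸 : Type*} [NormedRing 𝔸]

theorem Ring.inverse_sub_inverse_of_isUnit {R : Type*} [Ring R] {x y : R}
    (hx : IsUnit x) (hy : IsUnit y) :
    Ring.inverse x - Ring.inverse y = Ring.inverse x * (y - x) * Ring.inverse y := by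
  rw [mul_sub, sub_mul, mul_assoc, Ring.mul_inverse_cancel _ hy, Ring.inverse_mul_cancel _ hx,
    mul_one, one_mul]

variable [HasSummableGeomSeries 𝔸]

theorem ContinuousOn.ringInverse {Z : Type*} [TopologicalSpace Z] {A : Z → 𝔸} {s : Set Z}
    (hA : ContinuousOn A s) (hu : ∀ x ∈ s, IsUnit (A x)) :
    ContinuousOn (fun x ↦ Ring.inverse (A x)) s := by
  intro x hx
  obtain ⟨u, hux⟩ := hu x hx
  have h := NormedRing.inverse_continuousAt u
  rw [hux] at h
  exact h.comp_continuousWithinAt (hA x hx)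

theorem AbsolutelyContinuousOnInterval.ringInverse {A : ℝ → 𝔸} {a b : ℝ}
    (hA : AbsolutelyContinuousOnInterval A a b) (hu : ∀ x ∈ Set.uIcc a b, IsUnit (A x)) :
    AbsolutelyContinuousOnInterval (fun x ↦ Ring.inverse (A x)) a b := by
  obtain ⟨C, hC⟩ := isCompact_uIcc.exists_bound_of_continuousOn (hA.continuousOn.ringInverse hu)
  refine hA.of_dist_le (K := C * C) fun x hx y hy ↦ ?_
  have hC0 : 0 ≤ C := (norm_nonneg _).trans (hC x hx)
  rw [dist_eq_norm, Ring.inverse_sub_inverse_of_isUnit (hu x hx) (hu y hy), dist_comm,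
    dist_eq_norm]
  calc _ ≤ ‖Ring.inverse (A x)‖ * ‖A y - A x‖ * ‖Ring.inverse (A y)‖ := norm_mul₃_le
    _ ≤ C * ‖A y - A x‖ * C := by gcongr <;> [exact hC x hx; exact hC y hy]
    _ = C * C * ‖A y - A x‖ := by ring

/-- If `A` is a primitive of `-g` consisting of units, then its inverse is a primitive of
`A⁻¹ g A⁻¹`. -/
theorem Ring.inverse_eq_sub_integral [NormedAlgebra ℝ 𝔸] [CompleteSpace 𝔸] {A g : ℝ → 𝔸} {a b : ℝ}
    (hg : IntervalIntegrable g volume a b)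
    (hA : ∀ t, A t = A b + ∫ s in t..b, g s) (hu : ∀ t ∈ Set.uIcc a b, IsUnit (A t)) :
    IntervalIntegrable (fun s ↦ Ring.inverse (A s) * g s * Ring.inverse (A s)) volume a b ∧
    Ring.inverse (A a) =
      Ring.inverse (A b) - ∫ s in a..b, Ring.inverse (A s) * g s * Ring.inverse (A s) := by
  have hb : b ∈ Set.uIcc a b := Set.right_mem_uIcc
  have hA' : A = fun t ↦ A b - ∫ s in b..t, g s := by
    funext t
    rw [hA t, integral_symm, sub_eq_add_neg]
  have hAac : AbsolutelyContinuousOnInterval A a b := by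
    have hconst : AbsolutelyContinuousOnInterval (fun _ : ℝ ↦ A b) a b :=
      (LipschitzWith.const (A b)).lipschitzOnWith.absolutelyContinuousOnInterval
    have h := hconst.fun_sub (hg.absolutelyContinuousOnInterval_integral hb)
    rwa [← hA'] at h
  have hR := hAac.ringInverse hu
  have hint : IntervalIntegrable (fun s ↦ Ring.inverse (A s) * g s * Ring.inverse (A s))
      volume a b := (hg.continuousOn_mul hR.continuousOn).mul_continuousOn hR.continuousOn
  refine ⟨hint, ?_⟩
  have hF := hR.fun_sub (hint.absolutelyContinuousOnInterval_integral hb)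
  obtain ⟨C, hC⟩ := hF.const_of_ae_hasDerivAt_zero (by
    filter_upwards [hg.ae_hasDerivAt_integral, hint.ae_hasDerivAt_integral] with x hx₁ hx₂ hx
    have hAx : HasDerivAt A (-g x) x := by
      have h := (hx₁ hx b hb).const_sub (A b)
      rwa [← hA'] at h
    obtain ⟨u, hux⟩ := hu x hx
    have hinv : HasFDerivAt Ring.inverse
        (-ContinuousLinearMap.mulLeftRight ℝ 𝔸 ↑u⁻¹ ↑u⁻¹) (A x) :=
      hux ▸ hasFDerivAt_ringInverse u
    refine ((hinv.comp_hasDerivAt x hAx).sub (hx₂ hx b hb)).congr_deriv ?_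
    simp [← hux])
  have h := (hC a Set.left_mem_uIcc).trans (hC b hb).symm
  rw [integral_same, sub_zero, integral_symm, sub_neg_eq_add] at h
  exact eq_sub_of_add_eq h

end BanachAlgebra

section MatrixIntegral

variable {n : Type*} [Fintype n]

theorem Matrix.PosSemidef.of_integral {α : Type*} [MeasurableSpace α] {μ : Measure α}
    {M : α → Matrix n n ℝ} (hint : ∀ i j, Integrable (fun s ↦ M s i j) μ)
    (hM : ∀ᵐ s ∂μ, (M s).PosSemidef) :
    (Matrix.of fun i j ↦ ∫ s, M s i j ∂μ).PosSemidef := by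
  refine .of_dotProduct_mulVec_nonneg ?_ fun x ↦ ?_
  · ext i j
    simp only [Matrix.conjTranspose_apply, Matrix.of_apply, star_trivial]
    refine integral_congr_ae ?_
    filter_upwards [hM] with s hs
    simpa using hs.isHermitian.apply i j
  · have h : star x ⬝ᵥ (Matrix.of fun i j ↦ ∫ s, M s i j ∂μ).mulVec x =
        ∫ s, star x ⬝ᵥ (M s).mulVec x ∂μ := by
      simp only [dotProduct, Matrix.mulVec, Matrix.of_apply]
      rw [integral_finsetSum _ fun i _ ↦
        (integrable_finsetSum _ fun j _ ↦ (hint i j).mul_const _).const_mul _]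
      refine Finset.sum_congr rfl fun i _ ↦ ?_
      rw [MeasureTheory.integral_const_mul, integral_finsetSum _ fun j _ ↦ (hint i j).mul_const _]
      simp only [MeasureTheory.integral_mul_const]
    rw [h]
    refine integral_nonneg_of_ae ?_
    filter_upwards [hM] with s hs
    exact hs.dotProduct_mulVec_nonneg x

attribute [local instance] Matrix.linftyOpNormedRing Matrix.linftyOpNormedAlgebra

variable [DecidableEq n]

/-- Makes the topology of the operator norm the one found by instance search. -/
noncomputable local instance : TopologicalSpace (Matrix n n ℝ) :=
  (Matrix.linftyOpNormedRing : NormedRing (Matrix n n ℝ)).toMetricSpace.toPseudoMetricSpace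
    |>.toUniformSpace.toTopologicalSpace

theorem Matrix.intervalIntegrable_of_entry {M : ℝ → Matrix n n ℝ} {a b : ℝ}
    (h : ∀ i j, IntervalIntegrable (fun s ↦ M s i j) volume a b) :
    IntervalIntegrable M volume a b := by
  rw [intervalIntegrable_iff]
  have hM : M = fun s ↦ ∑ i, ∑ j, M s i j • Matrix.single i j (1 : ℝ) := by
    funext s
    simpa using Matrix.matrix_eq_sum_single (M s)
  rw [hM]
  exact integrable_finsetSum _ fun i _ ↦ integrable_finsetSum _ fun j _ ↦
    (intervalIntegrable_iff.1 (h i j)).smul_const _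

theorem Matrix.intervalIntegral_apply {M : ℝ → Matrix n n ℝ} {a b : ℝ}
    (h : IntervalIntegrable M volume a b) (i j : n) :
    (∫ s in a..b, M s) i j = ∫ s in a..b, M s i j :=
  ((LinearMap.toContinuousLinearMap
    (Matrix.entryLinearMap ℝ ℝ i j)).intervalIntegral_comp_comm h).symm

/-- If the matrices `P + ∫_t^b G` are invertible for `t` between `a` and `b`, then their inverse
`R` satisfies `R_a = P⁻¹ - ∫_a^b R G R`. -/
theorem Matrix.inv_add_integral_eq_sub_integral {G : ℝ → Matrix n n ℝ} {P : Matrix n n ℝ}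
    {R : ℝ → Matrix n n ℝ} {a b : ℝ}
    (hG : ∀ i j, IntervalIntegrable (fun s ↦ G s i j) volume a b)
    (hR : ∀ t, R t = (P + Matrix.of fun i j ↦ ∫ s in t..b, G s i j)⁻¹)
    (hu : ∀ t ∈ Set.uIcc a b, IsUnit (P + Matrix.of fun i j ↦ ∫ s in t..b, G s i j)) :
    R a = P⁻¹ - Matrix.of fun i j ↦ ∫ s in a..b, (R s * G s * R s) i j := by
  have hGM := Matrix.intervalIntegrable_of_entry hG
  have hof : ∀ t ∈ Set.uIcc a b,
      (Matrix.of fun i j ↦ ∫ s in t..b, G s i j) = ∫ s in t..b, G s := by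
    intro t ht
    ext i j
    exact (Matrix.intervalIntegral_apply
      (hGM.mono_set (Set.uIcc_subset_uIcc ht Set.right_mem_uIcc)) i j).symm
  have hRA : ∀ t ∈ Set.uIcc a b, R t = Ring.inverse (P + ∫ s in t..b, G s) := by
    intro t ht
    rw [hR, hof t ht, Matrix.nonsing_inv_eq_ringInverse]
  obtain ⟨hi, h⟩ := Ring.inverse_eq_sub_integral (A := fun t ↦ P + ∫ s in t..b, G s) hGM
    (fun t ↦ by simp) (fun t ht ↦ hof t ht ▸ hu t ht)
  have hcongr : ∀ s ∈ Set.uIcc a b, Ring.inverse (P + ∫ r in s..b, G r) * G s *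
      Ring.inverse (P + ∫ r in s..b, G r) = R s * G s * R s := by
    intro s hs
    rw [hRA s hs]
  rw [hRA a Set.left_mem_uIcc, h, integral_same, add_zero, ← Matrix.nonsing_inv_eq_ringInverse]
  congr 1
  ext i j
  rw [Matrix.intervalIntegral_apply hi, Matrix.of_apply]
  exact integral_congr fun s hs ↦ congrFun₂ (hcongr s hs) i j

end MatrixIntegral

/-- If `ξ` is symmetric positive definite and `η_s` is a.e. symmetric positive definite with
`s ↦ η_s⁻¹` integrable on `[0,T]`, then for every `t ∈ [0,T]` the matrix
`ξ⁻¹ + ∫_t^T η_s⁻¹ ds` is positive definite (hence invertible), `R_T = ξ`, and `R` solves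
the terminal-value Riccati equation `R_t = ξ − ∫_t^T R_s η_s⁻¹ R_s ds`. -/
theorem stmt8 {d : ℕ} (T : ℝ) (hT : 0 < T)
    (ξ : Matrix (Fin d) (Fin d) ℝ) (hξ : ξ.PosDef)
    (η : ℝ → Matrix (Fin d) (Fin d) ℝ)
    (hpd : ∀ᵐ s ∂(volume.restrict (Set.Icc (0 : ℝ) T)), (η s).PosDef)
    (hint : ∀ i j, IntegrableOn (fun s => (η s)⁻¹ i j) (Set.Icc (0 : ℝ) T)) :
    Rmat T ξ η T = ξ ∧
    ∀ t ∈ Set.Icc (0 : ℝ) T,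
      (ξ⁻¹ + Matrix.of fun i j => ∫ s in t..T, (η s)⁻¹ i j).PosDef ∧
      Rmat T ξ η t =
        ξ - Matrix.of fun i j => ∫ s in t..T, (Rmat T ξ η s * (η s)⁻¹ * Rmat T ξ η s) i j := by
  have hsub : ∀ {t}, t ∈ Set.Icc (0 : ℝ) T → Set.Icc t T ⊆ Set.Icc 0 T :=
    fun ht ↦ Set.Icc_subset_Icc_left ht.1
  have hpos : ∀ t ∈ Set.Icc (0 : ℝ) T,
      (ξ⁻¹ + Matrix.of fun i j => ∫ s in t..T, (η s)⁻¹ i j).PosDef := by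
    intro t ht
    refine hξ.inv.add_posSemidef ?_
    simp only [integral_of_le ht.2]
    have hIoc : Set.Ioc t T ⊆ Set.Icc 0 T := Set.Ioc_subset_Icc_self.trans (hsub ht)
    refine Matrix.PosSemidef.of_integral (fun i j ↦ (hint i j).mono_set hIoc) ?_
    filter_upwards [ae_restrict_of_ae_restrict_of_subset hIoc hpd] with s hs
    exact hs.inv.posSemidef
  have hinv : ξ⁻¹⁻¹ = ξ := Matrix.nonsing_inv_nonsing_inv ξ hξ.det_pos.ne'.isUnit
  refine ⟨?_, fun t ht ↦ ⟨hpos t ht, ?_⟩⟩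
  · have h0 : (Matrix.of fun i j => ∫ s in T..T, (η s)⁻¹ i j) = 0 := by
      ext i j
      simp
    rw [Rmat, h0, add_zero, hinv]
  · have h := Matrix.inv_add_integral_eq_sub_integral (R := Rmat T ξ η) (P := ξ⁻¹) (a := t)
      (b := T) (G := fun s ↦ (η s)⁻¹)
      (fun i j ↦ (intervalIntegrable_iff_integrableOn_Icc_of_le ht.2).2
        ((hint i j).mono_set (hsub ht)))
      (fun _ ↦ rfl)
      (fun s hs ↦ (hpos s (hsub ht (Set.uIcc_of_le ht.2 ▸ hs))).isUnit)
    rwa [hinv] at h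
end

section
/- Let d ∈ ℕ, T > 0, 0 ≤ t < T, and R, κ, D ≥ 0. Let f, g, N : [t,T] → ℝ^{d×d} be measurable functions such that for all s ∈ [t,T]: ‖f(s)‖ ≤ R (T − s)², ‖g(s)‖ ≤ R (T − s)², ‖f(s) − g(s)‖ ≤ D (T − s)², and ‖N(s)‖ ≤ κ. Then ∫_t^T (T − s)^{−2} ‖f(s) N(s) f(s) − g(s) N(s) g(s)‖ ds ≤ (2/3) R κ D (T − t)³. -/
open MeasureTheory

/-- The Frobenius norm of a real square matrix. -/
noncomputable def frob {d : ℕ} (A : Matrix (Fin d) (Fin d) ℝ) : ℝ :=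
  Real.sqrt (∑ i, ∑ j, (A i j) ^ 2)

section Frobenius

open scoped Matrix.Norms.Frobenius

theorem frob_eq_norm {d : ℕ} (A : Matrix (Fin d) (Fin d) ℝ) : frob A = ‖A‖ := by
  rw [Matrix.frobenius_norm_def, frob, Real.sqrt_eq_rpow]
  simp

theorem frob_nonneg {d : ℕ} (A : Matrix (Fin d) (Fin d) ℝ) : 0 ≤ frob A :=
  Real.sqrt_nonneg _

theorem frob_mul_mul_sub_mul_mul_le {d : ℕ} (A B M : Matrix (Fin d) (Fin d) ℝ) :
    frob (A * M * A - B * M * B) ≤ frob (A - B) * frob M * (frob A + frob B) := by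
  simp only [frob_eq_norm]
  have h : A * M * A - B * M * B = (A - B) * M * A + B * M * (A - B) := by noncomm_ring
  calc ‖A * M * A - B * M * B‖ = ‖(A - B) * M * A + B * M * (A - B)‖ := by rw [h]
    _ ≤ ‖A - B‖ * ‖M‖ * ‖A‖ + ‖B‖ * ‖M‖ * ‖A - B‖ :=
      norm_add_le_of_le (norm_mul₃_le ..) (norm_mul₃_le ..)
    _ = ‖A - B‖ * ‖M‖ * (‖A‖ + ‖B‖) := by ring

end Frobenius

theorem setIntegral_Ioc_sub_sq {t T : ℝ} (h : t ≤ T) :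
    ∫ s in Set.Ioc t T, (T - s) ^ 2 = (T - t) ^ 3 / 3 := by
  rw [← intervalIntegral.integral_of_le h,
    intervalIntegral.integral_comp_sub_left (fun x => x ^ 2), integral_pow]
  norm_num

/-- The contraction estimate for the fixed-point construction: if
`‖f(s)‖, ‖g(s)‖ ≤ R (T−s)²`, `‖f(s) − g(s)‖ ≤ D (T−s)²` and `‖N(s)‖ ≤ κ` on `[t,T]`, then
`∫_t^T (T−s)^{−2} ‖f(s) N(s) f(s) − g(s) N(s) g(s)‖ ds ≤ (2/3) R κ D (T−t)³`. -/
theorem stmt13 {d : ℕ} {T t R κ D : ℝ} (hT : 0 < T) (ht0 : 0 ≤ t) (htT : t < T)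
    (hR : 0 ≤ R) (hκ : 0 ≤ κ) (hD : 0 ≤ D)
    (f g N : ℝ → Matrix (Fin d) (Fin d) ℝ)
    (hfm : ∀ i j, Measurable fun s => f s i j)
    (hgm : ∀ i j, Measurable fun s => g s i j)
    (hNm : ∀ i j, Measurable fun s => N s i j)
    (hf : ∀ s ∈ Set.Icc t T, frob (f s) ≤ R * (T - s) ^ 2)
    (hg : ∀ s ∈ Set.Icc t T, frob (g s) ≤ R * (T - s) ^ 2)
    (hfg : ∀ s ∈ Set.Icc t T, frob (f s - g s) ≤ D * (T - s) ^ 2)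
    (hN : ∀ s ∈ Set.Icc t T, frob (N s) ≤ κ) :
    (∫ s in Set.Ioc t T, ((T - s) ^ 2)⁻¹ * frob (f s * N s * f s - g s * N s * g s))
      ≤ 2 / 3 * R * κ * D * (T - t) ^ 3 := by
  have hpt : ∀ s ∈ Set.Ioc t T,
      ((T - s) ^ 2)⁻¹ * frob (f s * N s * f s - g s * N s * g s)
        ≤ 2 * R * κ * D * (T - s) ^ 2 := by
    intro s hs
    have hs' := Set.Ioc_subset_Icc_self hs
    have hb : frob (f s * N s * f s - g s * N s * g s)
        ≤ D * (T - s) ^ 2 * κ * (R * (T - s) ^ 2 + R * (T - s) ^ 2) :=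
      (frob_mul_mul_sub_mul_mul_le _ _ _).trans <|
        mul_le_mul
          (mul_le_mul (hfg s hs') (hN s hs') (frob_nonneg _) (by positivity))
          (add_le_add (hf s hs') (hg s hs'))
          (add_nonneg (frob_nonneg _) (frob_nonneg _)) (by positivity)
    rcases hs.2.eq_or_lt with rfl | hlt
    · simp
    · have hpos : 0 < (T - s) ^ 2 := pow_pos (sub_pos.2 hlt) 2
      rw [inv_mul_le_iff₀ hpos]
      exact hb.trans_eq (by ring)
  have hint : IntegrableOn (fun s => 2 * R * κ * D * (T - s) ^ 2) (Set.Ioc t T) :=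
    (Continuous.integrableOn_Icc (by fun_prop)).mono_set Set.Ioc_subset_Icc_self
  calc _ ≤ ∫ s in Set.Ioc t T, 2 * R * κ * D * (T - s) ^ 2 :=
        integral_mono_of_nonneg
          (Filter.Eventually.of_forall fun s =>
            mul_nonneg (inv_nonneg.2 (sq_nonneg _)) (frob_nonneg _))
          hint (ae_restrict_of_forall_mem measurableSet_Ioc hpt)
    _ = 2 / 3 * R * κ * D * (T - t) ^ 3 := by
        rw [integral_const_mul, setIntegral_Ioc_sub_sq htT.le]
        ring
end
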